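/- Recursive lower bound: for every α ∈ [0,1] and every integer N ≥ 2, E^N_N(α) ≥ 4 · min{ E^N_k(α) : k an integer with ⌈N/4⌉ ≤ k ≤ N }. -/

import Mathlib

noncomputable section

open MeasureTheory Real Set
open scoped BigOperators Topology

/-- The plane `ℝ²`, with points written as pairs. -/
abbrev Plane : Type := ℝ × ℝ

/-- Configuration space of `N` particles in the plane. -/
abbrev Config (N : ℕ) : Type := Fin N → Plane

/-- `x^{-⊥} := (-y, x)/(x² + y²)` for `x = (x, y) ∈ ℝ²`. -/
def perpInv (v : Plane) : Plane :=
  (-v.2 / (v.1 ^ 2 + v.2 ^ 2), v.1 / (v.1 ^ 2 + v.2 ^ 2))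

/-- The Aharonov–Bohm potential `A_j(x) = ∑_{k ≠ j} (x_j - x_k)^{-⊥}`. -/
def abPot (N : ℕ) (j : Fin N) (x : Config N) : Plane :=
  ∑ k ∈ Finset.univ.erase j, perpInv (x j - x k)

/-- Partial derivative of `Ψ` at `x` in direction `v` of the `j`-th particle. -/
def pder (N : ℕ) (j : Fin N) (v : Plane) (Ψ : Config N → ℂ) (x : Config N) : ℂ :=
  fderiv ℝ Ψ x (Pi.single j v)

/-- The two components of `D_j Ψ = -i ∇_{x_j} Ψ + α A_j Ψ` at `x`. -/
def DOp (N : ℕ) (α : ℝ) (j : Fin N) (Ψ : Config N → ℂ) (x : Config N) : ℂ × ℂ :=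
  (-Complex.I * pder N j (1, 0) Ψ x + Complex.ofReal (α * (abPot N j x).1) * Ψ x,
   -Complex.I * pder N j (0, 1) Ψ x + Complex.ofReal (α * (abPot N j x).2) * Ψ x)

/-- `|D_j Ψ(x)|²`, the squared Euclidean norm of the vector `D_j Ψ(x) ∈ ℂ²`. -/
def DSq (N : ℕ) (α : ℝ) (j : Fin N) (Ψ : Config N → ℂ) (x : Config N) : ℝ :=
  ‖(DOp N α j Ψ x).1‖ ^ 2 + ‖(DOp N α j Ψ x).2‖ ^ 2

/-- The diagonal set `{x : x_j = x_k for some j ≠ k}`. -/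
def diagSet (N : ℕ) : Set (Config N) := {x | ∃ j k : Fin N, j ≠ k ∧ x j = x k}

/-- Admissible wave functions: smooth, symmetric, vanishing on a neighbourhood of
the diagonal set. -/
structure Admissible (N : ℕ) (Ψ : Config N → ℂ) : Prop where
  smooth : ContDiff ℝ (⊤ : ℕ∞) Ψ
  symm : ∀ (σ : Equiv.Perm (Fin N)) (x : Config N), Ψ (x ∘ σ) = Ψ x
  vanishes : ∃ U : Set (Config N), IsOpen U ∧ diagSet N ⊆ U ∧ ∀ x ∈ U, Ψ x = 0

/-- `Ω^N` as a subset of configuration space. -/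
def cube (N : ℕ) (Ω : Set Plane) : Set (Config N) := Set.univ.pi fun _ => Ω

/-- Total kinetic energy `∑_j ∫_{Ω^N} |D_j Ψ|²`. -/
def kinE (N : ℕ) (α : ℝ) (Ω : Set Plane) (Ψ : Config N → ℂ) : ℝ :=
  ∑ j, ∫ x in cube N Ω, DSq N α j Ψ x

/-- `∫_{Ω^N} |Ψ|²`. -/
def normSq (N : ℕ) (Ω : Set Plane) (Ψ : Config N → ℂ) : ℝ :=
  ∫ x in cube N Ω, ‖Ψ x‖ ^ 2

/-- Neumann ground-state energy of `N` anyons with statistics parameter `α` on `Ω`,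
with the convention that it is `0` for `N = 0`. -/
def neumannE (N : ℕ) (α : ℝ) (Ω : Set Plane) : ℝ :=
  if N = 0 then 0 else
    sInf {E | ∃ Ψ : Config N → ℂ, Admissible N Ψ ∧ normSq N Ω Ψ = 1 ∧ E = kinE N α Ω Ψ}

/-- Dirichlet ground-state energy of `N` anyons with statistics parameter `α` on `Ω`. -/
def dirichletE (N : ℕ) (α : ℝ) (Ω : Set Plane) : ℝ :=
  sInf {E | ∃ Ψ : Config N → ℂ, Admissible N Ψ ∧ IsCompact (tsupport Ψ) ∧
    tsupport Ψ ⊆ cube N Ω ∧ normSq N Ω Ψ = 1 ∧ E = kinE N α Ω Ψ}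

/-- The open unit square `Q₀ = (0,1)²`. -/
def Q0 : Set Plane := Set.Ioo (0 : ℝ) 1 ×ˢ Set.Ioo (0 : ℝ) 1

/-- `E^N_N(α)`, the Neumann energy on the unit square. -/
def EN (N : ℕ) (α : ℝ) : ℝ := neumannE N α Q0

/-- `E^D_N(α)`, the Dirichlet energy on the unit square. -/
def ED (N : ℕ) (α : ℝ) : ℝ := dirichletE N α Q0

/-- One-particle density `ρ_Ψ` of a wave function of `n+1` particles. -/
def density (n : ℕ) (Ψ : Config (n + 1) → ℂ) (y : Plane) : ℝ :=
  (n + 1) * ∫ z : Config n, ‖Ψ (Fin.cons y z)‖ ^ 2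


theorem perpInv_zero : perpInv 0 = 0 := by
  simp [perpInv]

theorem abPot_eq (N : ℕ) (j : Fin N) (x : Config N) :
    abPot N j x = ∑ k, perpInv (x j - x k) := by
  unfold abPot
  rw [← Finset.sum_erase_add Finset.univ _ (Finset.mem_univ j)]
  simp [perpInv_zero]

theorem perpInv_half (v : Plane) : perpInv ((1/2 : ℝ) • v) = (2 : ℝ) • perpInv v := by
  unfold perpInv
  by_cases h : v.1 ^ 2 + v.2 ^ 2 = 0
  · have h2 : ((1/2 : ℝ) * v.1) ^ 2 + ((1/2 : ℝ) * v.2) ^ 2 = 0 := by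
      have : ((1/2 : ℝ) * v.1) ^ 2 + ((1/2 : ℝ) * v.2) ^ 2 = (1/4) * (v.1 ^ 2 + v.2 ^ 2) := by ring
      rw [this, h]; simp
    simp only [Prod.smul_fst, Prod.smul_snd, smul_eq_mul, h2, h]
    simp
  · have h2 : ((1/2 : ℝ) * v.1) ^ 2 + ((1/2 : ℝ) * v.2) ^ 2 = (1/4) * (v.1 ^ 2 + v.2 ^ 2) := by ring
    simp only [Prod.smul_fst, Prod.smul_snd, smul_eq_mul, h2, Prod.smul_mk]
    ext
    · simp only; field_simp; ring
    · simp only; field_simp; ring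

theorem perpInv_continuousAt {v : Plane} (hv : v ≠ 0) : ContinuousAt perpInv v := by
  have h : v.1 ^ 2 + v.2 ^ 2 ≠ 0 := by
    intro h
    apply hv
    have h1 : v.1 = 0 := by nlinarith [sq_nonneg v.1, sq_nonneg v.2]
    have h2 : v.2 = 0 := by nlinarith [sq_nonneg v.1, sq_nonneg v.2]
    exact Prod.ext h1 h2
  unfold perpInv
  apply ContinuousAt.prodMk
  · exact ContinuousAt.div (by fun_prop) (by fun_prop) h
  · exact ContinuousAt.div (by fun_prop) (by fun_prop) h

theorem abPot_continuousAt {N : ℕ} (j : Fin N) {x : Config N} (hx : x ∉ diagSet N) :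
    ContinuousAt (abPot N j) x := by
  unfold abPot
  refine tendsto_finsetSum _ fun k hk => ?_
  have hjk : x j - x k ≠ 0 := by
    intro h
    exact hx ⟨j, k, (Finset.ne_of_mem_erase hk).symm, sub_eq_zero.1 h⟩
  have h1 : ContinuousAt (fun y : Config N => y j - y k) x := by fun_prop
  exact ContinuousAt.comp (f := fun y : Config N => y j - y k) (g := perpInv)
    (perpInv_continuousAt hjk) h1

theorem pot_mul_continuous {N : ℕ} {Ψ : Config N → ℂ} (h : Admissible N Ψ) (α : ℝ) (j : Fin N)
    (p : Plane → ℝ) (hp : Continuous p) :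
    Continuous fun x => Complex.ofReal (α * p (abPot N j x)) * Ψ x := by
  rw [continuous_iff_continuousAt]
  intro x
  by_cases hx : x ∈ diagSet N
  · obtain ⟨U, hU, hdU, hz⟩ := h.vanishes
    have : (fun x => Complex.ofReal (α * p (abPot N j x)) * Ψ x) =ᶠ[𝓝 x] fun _ => 0 := by
      filter_upwards [hU.mem_nhds (hdU hx)] with y hy
      rw [hz y hy, mul_zero]
    exact continuousAt_const.congr this.symm
  · have h1 := abPot_continuousAt j hx
    have h2 : ContinuousAt Ψ x := h.smooth.continuous.continuousAt
    have h3 : ContinuousAt (fun y => p (abPot N j y)) x :=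
      ContinuousAt.comp (f := abPot N j) hp.continuousAt h1
    have h4 : ContinuousAt (fun y => Complex.ofReal (α * p (abPot N j y))) x :=
      ContinuousAt.comp (g := Complex.ofReal) Complex.continuous_ofReal.continuousAt
        (continuousAt_const.mul h3)
    exact h4.mul h2

theorem pder_continuous {N : ℕ} {Ψ : Config N → ℂ} (h : Admissible N Ψ) (j : Fin N) (v : Plane) :
    Continuous (pder N j v Ψ) := by
  have := h.smooth.continuous_fderiv (by simp)
  unfold pder
  fun_prop

theorem DSq_continuous {N : ℕ} {Ψ : Config N → ℂ} (h : Admissible N Ψ) (α : ℝ) (j : Fin N) :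
    Continuous (DSq N α j Ψ) := by
  have h1 := pot_mul_continuous h α j Prod.fst continuous_fst
  have h2 := pot_mul_continuous h α j Prod.snd continuous_snd
  have h3 := pder_continuous h j (1, 0)
  have h4 := pder_continuous h j (0, 1)
  unfold DSq DOp
  simp only
  fun_prop

theorem DSq_nonneg (N : ℕ) (α : ℝ) (j : Fin N) (Ψ : Config N → ℂ) (x : Config N) :
    0 ≤ DSq N α j Ψ x := by unfold DSq; positivity

theorem kinE_nonneg (N : ℕ) (α : ℝ) (Ω : Set Plane) (Ψ : Config N → ℂ) : 0 ≤ kinE N α Ω Ψ :=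
  Finset.sum_nonneg fun j _ => integral_nonneg fun x => DSq_nonneg N α j Ψ x

theorem isOpen_Q0 : IsOpen Q0 := isOpen_Ioo.prod isOpen_Ioo

theorem isOpen_cube (N : ℕ) {Ω : Set Plane} (h : IsOpen Ω) : IsOpen (cube N Ω) :=
  isOpen_set_pi Set.finite_univ fun _ _ => h

theorem integrableOn_cube {N : ℕ} {f : Config N → ℝ} (hf : Continuous f) {S : Set (Config N)}
    (hS : S ⊆ cube N Q0) : IntegrableOn f S := by
  have hK : IsCompact (Set.univ.pi fun _ : Fin N => (Set.Icc (0:ℝ) 1 ×ˢ Set.Icc (0:ℝ) 1 : Set Plane)) :=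
    isCompact_univ_pi fun _ => isCompact_Icc.prod isCompact_Icc
  refine (hf.continuousOn.integrableOn_compact hK).mono_set (hS.trans ?_)
  exact Set.pi_mono fun _ _ => Set.prod_mono Set.Ioo_subset_Icc_self Set.Ioo_subset_Icc_self

theorem EN_nonneg (N : ℕ) (α : ℝ) : 0 ≤ EN N α := by
  unfold EN neumannE
  split_ifs
  · exact le_rfl
  · apply Real.sInf_nonneg
    rintro E ⟨Ψ, -, -, rfl⟩
    exact kinE_nonneg _ _ _ _

theorem Admissible.const_mul {N : ℕ} {Ψ : Config N → ℂ} (h : Admissible N Ψ) (c : ℂ) :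
    Admissible N (fun x => c * Ψ x) where
  smooth := contDiff_const.mul h.smooth
  symm σ x := by rw [h.symm]
  vanishes := by
    obtain ⟨U, hU, hd, hz⟩ := h.vanishes
    exact ⟨U, hU, hd, fun x hx => by rw [hz x hx, mul_zero]⟩

theorem DSq_const_mul {N : ℕ} {Ψ : Config N → ℂ} (h : Admissible N Ψ) (c : ℂ) (α : ℝ) (j : Fin N)
    (x : Config N) : DSq N α j (fun x => c * Ψ x) x = ‖c‖ ^ 2 * DSq N α j Ψ x := by
  have hd : DifferentiableAt ℝ Ψ x := h.smooth.differentiable (by simp) x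
  have hp : ∀ v, pder N j v (fun x => c * Ψ x) x = c * pder N j v Ψ x := by
    intro v
    unfold pder
    rw [fderiv_const_mul hd]
    rfl
  unfold DSq DOp
  simp only [hp]
  have e1 : ∀ a b : ℂ, -Complex.I * (c * a) + b * (c * Ψ x) = c * (-Complex.I * a + b * Ψ x) := by
    intro a b; ring
  rw [e1, e1, norm_mul, norm_mul]
  ring

/-- The variational inequality without normalisation. -/
theorem EN_mul_le {N : ℕ} (hN : N ≠ 0) {Ψ : Config N → ℂ} (h : Admissible N Ψ) (α : ℝ) :
    EN N α * normSq N Q0 Ψ ≤ kinE N α Q0 Ψ := by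
  have h0 : 0 ≤ normSq N Q0 Ψ := integral_nonneg fun x => by positivity
  rcases h0.eq_or_lt with h1 | h1
  · rw [← h1, mul_zero]; exact kinE_nonneg _ _ _ _
  · set c : ℂ := (((Real.sqrt (normSq N Q0 Ψ))⁻¹ : ℝ) : ℂ) with hc
    have hc2 : ‖c‖ ^ 2 = (normSq N Q0 Ψ)⁻¹ := by
      rw [hc, Complex.norm_real, Real.norm_eq_abs, sq_abs, inv_pow, Real.sq_sqrt h0]
    have hn : normSq N Q0 (fun x => c * Ψ x) = 1 := by
      unfold normSq
      simp only [norm_mul, mul_pow]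
      rw [integral_const_mul, hc2]
      exact inv_mul_cancel₀ h1.ne'
    have hk : kinE N α Q0 (fun x => c * Ψ x) = (normSq N Q0 Ψ)⁻¹ * kinE N α Q0 Ψ := by
      unfold kinE
      rw [Finset.mul_sum]
      refine Finset.sum_congr rfl fun j _ => ?_
      rw [← integral_const_mul]
      simp only [DSq_const_mul h, hc2]
    have : EN N α ≤ (normSq N Q0 Ψ)⁻¹ * kinE N α Q0 Ψ := by
      unfold EN neumannE
      rw [if_neg hN, ← hk]
      apply csInf_le
      · refine ⟨0, ?_⟩
        rintro E ⟨Ψ, -, -, rfl⟩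
        exact kinE_nonneg _ _ _ _
      · exact ⟨_, h.const_mul c, hn, rfl⟩
    calc _ ≤ ((normSq N Q0 Ψ)⁻¹ * kinE N α Q0 Ψ) * normSq N Q0 Ψ :=
          mul_le_mul_of_nonneg_right this h0
      _ = kinE N α Q0 Ψ := by field_simp

/-- There are normalised admissible functions. -/
theorem exists_admissible (N : ℕ) :
    ∃ Ψ : Config N → ℂ, Admissible N Ψ ∧ normSq N Q0 Ψ = 1 := by
  let d : Plane → ℝ := fun v => v.1 ^ 2 + v.2 ^ 2
  let M : ℝ := 2 * (N + 1) ^ 2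
  let h : Plane → ℝ := fun v => Real.smoothTransition (M * d v - 1)
  have hh : ContDiff ℝ (⊤ : ℕ∞) h := by
    refine Real.smoothTransition.contDiff.comp ?_
    fun_prop
  let Ψ : Config N → ℂ := fun x => ((∏ p : Fin N × Fin N, if p.1 = p.2 then 1 else h (x p.1 - x p.2) : ℝ) : ℂ)
  have hΨ : Admissible N Ψ := by
    refine ⟨?_, ?_, ?_⟩
    · refine Complex.ofRealCLM.contDiff.comp ?_
      refine contDiff_prod fun p _ => ?_
      split_ifs
      · exact contDiff_const
      · exact hh.comp (by fun_prop)
    · intro σ x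
      simp only [Ψ, Function.comp]
      congr 1
      refine Fintype.prod_equiv (Equiv.prodCongr σ σ) _ _ fun p => ?_
      simp
    · refine ⟨{x | ∃ p : Fin N × Fin N, p.1 ≠ p.2 ∧ M * d (x p.1 - x p.2) < 1}, ?_, ?_, ?_⟩
      · have : {x : Config N | ∃ p : Fin N × Fin N, p.1 ≠ p.2 ∧ M * d (x p.1 - x p.2) < 1}
            = ⋃ p : Fin N × Fin N, ⋃ (_ : p.1 ≠ p.2), {x | M * d (x p.1 - x p.2) < 1} := by
          ext; simp
        rw [this]
        refine isOpen_iUnion fun p => isOpen_iUnion fun _ => ?_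
        exact isOpen_lt (by fun_prop) continuous_const
      · rintro x ⟨j, k, hjk, e⟩
        refine ⟨(j, k), hjk, ?_⟩
        simp [e, d]
      · rintro x ⟨p, hp, hlt⟩
        simp only [Ψ]
        rw [Finset.prod_eq_zero (Finset.mem_univ p), Complex.ofReal_zero]
        rw [if_neg hp]
        exact Real.smoothTransition.zero_of_nonpos (by linarith)
  have hpos : 0 < normSq N Q0 Ψ := by
    unfold normSq
    have hc : Continuous fun x => ‖Ψ x‖ ^ 2 := by
      have := hΨ.smooth.continuous
      fun_prop
    rw [setIntegral_pos_iff_support_of_nonneg_ae (Filter.Eventually.of_forall fun x => by positivity)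
      (integrableOn_cube hc subset_rfl)]
    refine IsOpen.measure_pos _ (hc.isOpen_support.inter (isOpen_cube N isOpen_Q0)) ?_
    refine ⟨fun j => (((j : ℕ) + 1 : ℝ) / (N + 1), 1 / 2), ?_, ?_⟩
    · rw [Function.mem_support]
      refine pow_ne_zero _ (norm_ne_zero_iff.2 ?_)
      simp only [Ψ]
      rw [Complex.ofReal_ne_zero, Finset.prod_ne_zero_iff]
      intro p _
      split_ifs with hp
      · exact one_ne_zero
      · refine (Real.smoothTransition.pos_of_pos ?_).ne'
        simp only [M, d]
        have hN : (0:ℝ) < N + 1 := by positivity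
        have h1 : (1:ℝ) ≤ ((p.1 : ℕ) - (p.2 : ℕ) : ℝ) ^ 2 := by
          have : ((p.1 : ℕ) : ℤ) - ((p.2 : ℕ) : ℤ) ≠ 0 := by
            intro h; apply hp; apply Fin.ext; omega
          have h2 : (1:ℤ) ≤ (((p.1 : ℕ) : ℤ) - ((p.2 : ℕ) : ℤ)) ^ 2 := by
            have := sq_pos_of_ne_zero this
            omega
          exact_mod_cast h2
        have : 2 * ((N:ℝ) + 1) ^ 2 * ((((p.1:ℕ) + 1 : ℝ) / (N + 1) - ((p.2:ℕ) + 1 : ℝ) / (N + 1)) ^ 2 + ((1:ℝ)/2 - 1/2) ^ 2)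
          = 2 * ((p.1 : ℕ) - (p.2 : ℕ) : ℝ) ^ 2 := by field_simp; ring
        simp only [Prod.mk_sub_mk]
        rw [this]; linarith
    · intro j _
      have hN : (0:ℝ) < N + 1 := by positivity
      have hj : ((j : ℕ) : ℝ) < N := by exact_mod_cast j.2
      refine ⟨⟨by positivity, ?_⟩, by norm_num, by norm_num⟩
      rw [div_lt_one hN]; linarith
  set c : ℂ := (((Real.sqrt (normSq N Q0 Ψ))⁻¹ : ℝ) : ℂ) with hc
  have hc2 : ‖c‖ ^ 2 = (normSq N Q0 Ψ)⁻¹ := by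
    rw [hc, Complex.norm_real, Real.norm_eq_abs, sq_abs, inv_pow, Real.sq_sqrt hpos.le]
  refine ⟨_, hΨ.const_mul c, ?_⟩
  unfold normSq
  simp only [norm_mul, mul_pow]
  rw [integral_const_mul, hc2]
  exact inv_mul_cancel₀ hpos.ne'

/-- The two halves of the unit interval. -/
def halfI (a : Bool) : Set ℝ := if a then Set.Ioo (1/2) 1 else Set.Ioo 0 (1/2)

/-- The four quarter squares. -/
def sq4 (q : Bool × Bool) : Set Plane := halfI q.1 ×ˢ halfI q.2

/-- The (rescaled) lower left corners of the quarter squares. -/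
def corner (q : Bool × Bool) : Plane := (if q.1 then 1 else 0, if q.2 then 1 else 0)

theorem isOpen_halfI (a : Bool) : IsOpen (halfI a) := by
  cases a <;> simp [halfI, isOpen_Ioo]

theorem isOpen_sq4 (q : Bool × Bool) : IsOpen (sq4 q) := (isOpen_halfI _).prod (isOpen_halfI _)

theorem halfI_mem (a : Bool) (t : ℝ) :
    (1/2 : ℝ) * (t + if a then 1 else 0) ∈ halfI a ↔ t ∈ Set.Ioo (0:ℝ) 1 := by
  cases a
  · simp only [halfI, Bool.false_eq_true, if_false, Set.mem_Ioo]
    constructor <;> rintro ⟨h1, h2⟩ <;> constructor <;> linarith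
  · simp only [halfI, if_true, Set.mem_Ioo]
    constructor <;> rintro ⟨h1, h2⟩ <;> constructor <;> linarith

theorem sq4_mem (q : Bool × Bool) (w : Plane) :
    (1/2 : ℝ) • (w + corner q) ∈ sq4 q ↔ w ∈ Q0 := by
  unfold sq4 Q0 corner
  rw [Set.mem_prod, Set.mem_prod]
  exact and_congr (halfI_mem q.1 w.1) (halfI_mem q.2 w.2)

theorem exists_g_aux (c : ℝ) (hc : c < 1/2) : ∃ g : ℝ → ℝ, ContDiff ℝ (⊤ : ℕ∞) g ∧ (∀ t, g t ≠ 0) ∧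
    ∀ t, 1/2 ≤ t → g t = t - c := by
  let S : ℝ → ℝ := fun t => Real.smoothTransition ((t - c) / (1/2 - c))
  have hS : ContDiff ℝ (⊤ : ℕ∞) S := Real.smoothTransition.contDiff.comp (by fun_prop)
  have hd : 0 < 1/2 - c := by linarith
  refine ⟨fun t => (t - c) * S t + (1 - S t), by fun_prop, ?_, ?_⟩
  · intro t
    have h1 : S t ≤ 1 := Real.smoothTransition.le_one _
    rcases le_or_gt t c with h | h
    · have : S t = 0 := Real.smoothTransition.zero_of_nonpos
        (div_nonpos_of_nonpos_of_nonneg (by linarith) hd.le)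
      simp [this]
    · have h2 : 0 < S t := Real.smoothTransition.pos_of_pos (div_pos (by linarith) hd)
      have : 0 < (t - c) * S t := mul_pos (by linarith) h2
      exact (by linarith : 0 < (t - c) * S t + (1 - S t)).ne'
  · intro t ht
    have : S t = 1 := Real.smoothTransition.one_of_one_le (by rw [le_div_iff₀ hd]; linarith)
    simp [this]

theorem exists_g (a b : Bool) (hab : a ≠ b) (c : ℝ) (hc : c ∈ halfI b) :
    ∃ g : ℝ → ℝ, ContDiff ℝ (⊤ : ℕ∞) g ∧ (∀ t, g t ≠ 0) ∧ ∀ t ∈ halfI a, g t = t - c := by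
  cases a
  · have hb : b = true := by cases b <;> simp_all
    subst hb
    simp only [halfI, if_true, Set.mem_Ioo] at hc
    obtain ⟨g, h1, h2, h3⟩ := exists_g_aux (1 - c) (by linarith)
    refine ⟨fun t => - g (1 - t), by fun_prop, fun t => neg_ne_zero.2 (h2 _), fun t ht => ?_⟩
    simp only [halfI, Bool.false_eq_true, if_false, Set.mem_Ioo] at ht
    have h4 := h3 (1 - t) (by linarith)
    simp only [h4]; ring
  · have hb : b = false := by cases b <;> simp_all
    subst hb
    simp only [halfI, Bool.false_eq_true, if_false, Set.mem_Ioo] at hc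
    obtain ⟨g, h1, h2, h3⟩ := exists_g_aux c (by linarith)
    refine ⟨g, h1, h2, fun t ht => ?_⟩
    simp only [halfI, if_true, Set.mem_Ioo] at ht
    exact h3 _ (by linarith)

theorem arctan_quot_deriv (g : ℝ → ℝ) (hg : ∀ t, g t ≠ 0) (d c : ℝ) (x : Plane)
    (hgx : g =ᶠ[𝓝 x.1] fun t => t - c) :
    HasFDerivAt (fun u : Plane => Real.arctan ((u.2 - d) * (g u.1)⁻¹))
      ((1 / (1 + ((x.2 - d) * (g x.1)⁻¹) ^ 2)) • ((x.2 - d) • ((-1 / (g x.1) ^ 2) •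
        ContinuousLinearMap.fst ℝ ℝ ℝ) + (g x.1)⁻¹ • ContinuousLinearMap.snd ℝ ℝ ℝ)) x := by
  have h1 : HasDerivAt g 1 x.1 := ((hasDerivAt_id x.1).sub_const c).congr_of_eventuallyEq hgx
  have h2 := h1.inv (hg _)
  have h3 : HasFDerivAt (fun u : Plane => (g u.1)⁻¹)
      ((-1 / (g x.1) ^ 2) • ContinuousLinearMap.fst ℝ ℝ ℝ) x :=
    HasDerivAt.comp_hasFDerivAt (f := fun u : Plane => u.1) (h₂ := fun t => (g t)⁻¹) x h2 hasFDerivAt_fst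
  have h4 : HasFDerivAt (fun u : Plane => u.2 - d) (ContinuousLinearMap.snd ℝ ℝ ℝ) x :=
    hasFDerivAt_snd.sub_const d
  exact (h4.mul h3).arctan

theorem exists_gauge (p q : Bool × Bool) (hpq : p ≠ q) (c : Plane) (hc : c ∈ sq4 p) :
    ∃ θ : Plane → ℝ, ContDiff ℝ (⊤ : ℕ∞) θ ∧ ∀ x ∈ sq4 q, ∀ v : Plane,
      fderiv ℝ θ x v = (perpInv (x - c)).1 * v.1 + (perpInv (x - c)).2 * v.2 := by
  by_cases h1 : q.1 = p.1
  · have h2 : q.2 ≠ p.2 := fun h => hpq (Prod.ext h1 h).symm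
    obtain ⟨g, hg, hg0, hgc⟩ := exists_g q.2 p.2 h2 c.2 hc.2
    refine ⟨fun u => - Real.arctan ((u.1 - c.1) * (g u.2)⁻¹), ?_, ?_⟩
    · refine (Real.contDiff_arctan.comp ?_).neg
      exact ContDiff.mul (by fun_prop) ((hg.comp contDiff_snd).inv fun u => hg0 _)
    · intro x hx v
      have hgx : g =ᶠ[𝓝 x.2] fun t => t - c.2 :=
        Filter.eventuallyEq_of_mem ((isOpen_halfI _).mem_nhds hx.2) hgc
      have h3 := (arctan_quot_deriv g hg0 c.1 c.2 x.swap hgx).comp x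
        (ContinuousLinearEquiv.prodComm ℝ ℝ ℝ).hasFDerivAt
      have h4 : HasFDerivAt (fun u : Plane => - Real.arctan ((u.1 - c.1) * (g u.2)⁻¹)) _ x := h3.neg
      rw [h4.fderiv]
      have h5 : g x.2 = x.2 - c.2 := hgc _ hx.2
      have h6 : x.2 - c.2 ≠ 0 := h5 ▸ hg0 x.2
      have h7 : (x.1 - c.1) ^ 2 + (x.2 - c.2) ^ 2 ≠ 0 := by positivity
      have h8 : (x.2 - c.2) ^ 2 + (x.1 - c.1) ^ 2 ≠ 0 := by positivity
      simp [perpInv, h5]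
      field_simp
      ring
  · obtain ⟨g, hg, hg0, hgc⟩ := exists_g q.1 p.1 h1 c.1 hc.1
    refine ⟨fun u => Real.arctan ((u.2 - c.2) * (g u.1)⁻¹), ?_, ?_⟩
    · refine (Real.contDiff_arctan.comp ?_)
      exact ContDiff.mul (by fun_prop) ((hg.comp contDiff_fst).inv fun u => hg0 _)
    · intro x hx v
      have hgx : g =ᶠ[𝓝 x.1] fun t => t - c.1 :=
        Filter.eventuallyEq_of_mem ((isOpen_halfI _).mem_nhds hx.1) hgc
      rw [(arctan_quot_deriv g hg0 c.2 c.1 x hgx).fderiv]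
      have h5 : g x.1 = x.1 - c.1 := hgc _ hx.1
      have h6 : x.1 - c.1 ≠ 0 := h5 ▸ hg0 x.1
      have h7 : (x.1 - c.1) ^ 2 + (x.2 - c.2) ^ 2 ≠ 0 := by positivity
      have h8 : (x.2 - c.2) ^ 2 + (x.1 - c.1) ^ 2 ≠ 0 := by positivity
      simp [perpInv, h5]
      field_simp
      ring

/-- Assembling a configuration of `N` particles from a configuration of the particles
satisfying `P` and the remaining ones. -/
def asm {N n : ℕ} {P : Fin N → Prop} [DecidablePred P] (e : Fin n ≃ {j // P j})
    (y : {j // ¬ P j} → Plane) (z : Config n) : Config N :=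
  fun j => if h : P j then z (e.symm ⟨j, h⟩) else y ⟨j, h⟩

section asm

variable {N n : ℕ} {P : Fin N → Prop} [DecidablePred P] (e : Fin n ≃ {j // P j})
    (y : {j // ¬ P j} → Plane) (b : Plane)

theorem asm_apply_e (z : Config n) (i : Fin n) : asm e y z (e i) = z i := by
  have h := (e i).2
  simp [asm, h]

theorem asm_apply_not (z : Config n) (k : {j // ¬ P j}) : asm e y z k = y k := by
  have h := k.2
  simp [asm, h]

/-- Rescaled assembling. -/
def asmS (z : Config n) : Config N := asm e y fun i => (1/2 : ℝ) • (z i + b)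

/-- The derivative of `asmS`. -/
def asmD : Config n →L[ℝ] Config N :=
  ContinuousLinearMap.pi fun j => if h : P j then
    (1/2 : ℝ) • ContinuousLinearMap.proj (R := ℝ) (φ := fun _ : Fin n => Plane) (e.symm ⟨j, h⟩) else 0

theorem asmS_contDiff : ContDiff ℝ (⊤ : ℕ∞) (asmS e y b) := by
  rw [contDiff_pi]
  intro j
  unfold asmS asm
  by_cases h : P j
  · simp only [h, dite_true]; fun_prop
  · simp only [h, dite_false]; fun_prop

theorem asmS_hasFDerivAt (z : Config n) : HasFDerivAt (asmS e y b) (asmD e) z := by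
  rw [hasFDerivAt_pi']
  intro j
  unfold asmS asm asmD
  by_cases h : P j
  · simp only [h, dite_true, ContinuousLinearMap.proj_pi]
    exact ((hasFDerivAt_apply (𝕜 := ℝ) (F' := fun _ : Fin n => Plane) (e.symm ⟨j, h⟩) z).add_const b).const_smul (1/2 : ℝ)
  · simp only [h, dite_false, ContinuousLinearMap.proj_pi]
    exact hasFDerivAt_const _ _

theorem asmD_single (i : Fin n) (v : Plane) :
    asmD e (Pi.single i v) = (1/2 : ℝ) • (Pi.single (e i : Fin N) v : Config N) := by
  funext j
  by_cases h : P j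
  · obtain ⟨k, hk⟩ := e.surjective ⟨j, h⟩
    have hj : j = e k := by rw [hk]
    subst hj
    have : (e k).1 = (e i).1 ↔ k = i := by
      rw [← Subtype.ext_iff, e.injective.eq_iff]
    simp [asmD, (e k).2, Pi.single_apply, this]
  · have : j ≠ e i := fun hj => h (hj ▸ (e i).2)
    simp [asmD, h, this]

theorem asmS_perm (σ : Equiv.Perm (Fin n)) (z : Config n) :
    asmS e y b (z ∘ σ) = asmS e y b z ∘ (σ.extendDomain e) := by
  funext j
  by_cases h : P j
  · obtain ⟨k, hk⟩ := e.surjective ⟨j, h⟩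
    have hj : j = e k := by rw [hk]
    subst hj
    rw [Function.comp, Equiv.Perm.extendDomain_apply_image]
    unfold asmS
    rw [asm_apply_e, asm_apply_e]
    rfl
  · rw [Function.comp, Equiv.Perm.extendDomain_apply_not_subtype _ _ h]
    simp [asmS, asm, h]

theorem sum_split {M : Type*} [AddCommMonoid M] (f : Fin N → M) :
    ∑ j, f j = ∑ i : Fin n, f (e i) + ∑ k : {j // ¬ P j}, f k := by
  rw [← Fintype.sum_subtype_add_sum_subtype P f]
  congr 1
  exact (Equiv.sum_comp e (fun j => f j)).symm

theorem abPot_asmS (z : Config n) (i : Fin n) :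
    abPot N (e i) (asmS e y b z) = (2 : ℝ) • abPot n i z +
      ∑ k, perpInv ((1/2 : ℝ) • (z i + b) - y k) := by
  rw [abPot_eq, sum_split e, abPot_eq, Finset.smul_sum]
  unfold asmS
  simp only [asm_apply_e, asm_apply_not]
  congr 1
  refine Finset.sum_congr rfl fun k _ => ?_
  rw [← smul_sub, perpInv_half]
  congr 2
  abel

/-- The gauge transformed and rescaled restriction. -/
def gaugeFn (α : ℝ) (G : Plane → ℝ) (Ψ : Config N → ℂ) (z : Config n) : ℂ :=
  Complex.exp (Complex.I * ((α * ∑ i, G (z i) : ℝ) : ℂ)) * Ψ (asmS e y b z)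

theorem gaugeFn_norm (α : ℝ) (G : Plane → ℝ) (Ψ : Config N → ℂ) (z : Config n) :
    ‖gaugeFn e y b α G Ψ z‖ = ‖Ψ (asmS e y b z)‖ := by
  unfold gaugeFn
  rw [norm_mul, mul_comm Complex.I, Complex.norm_exp_ofReal_mul_I, one_mul]

theorem gaugeFn_admissible (α : ℝ) {G : Plane → ℝ} (hG : ContDiff ℝ (⊤ : ℕ∞) G)
    {Ψ : Config N → ℂ} (h : Admissible N Ψ) : Admissible n (gaugeFn e y b α G Ψ) := by
  refine ⟨?_, ?_, ?_⟩
  · unfold gaugeFn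
    refine ContDiff.mul (ContDiff.cexp ?_) (h.smooth.comp (asmS_contDiff e y b))
    refine contDiff_const.mul (Complex.ofRealCLM.contDiff.comp ?_)
    refine contDiff_const.mul (ContDiff.sum fun i _ => hG.comp ?_)
    fun_prop
  · intro σ z
    unfold gaugeFn
    rw [asmS_perm, h.symm]
    simp only [Function.comp]
    rw [Equiv.sum_comp σ (fun i => G (z i))]
  · obtain ⟨U, hU, hd, hz⟩ := h.vanishes
    refine ⟨asmS e y b ⁻¹' U, hU.preimage (asmS_contDiff e y b).continuous, ?_, ?_⟩
    · rintro z ⟨j, k, hjk, hz⟩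
      refine hd ⟨e j, e k, ?_, ?_⟩
      · intro h; exact hjk (e.injective (Subtype.ext h))
      · unfold asmS
        rw [asm_apply_e, asm_apply_e, hz]
    · intro z hzU
      unfold gaugeFn
      rw [hz _ hzU, mul_zero]

theorem gaugeFn_pder (α : ℝ) {G : Plane → ℝ} (hG : ContDiff ℝ (⊤ : ℕ∞) G)
    {Ψ : Config N → ℂ} (h : Admissible N Ψ) (z : Config n) (i : Fin n) (v : Plane) :
    pder n i v (gaugeFn e y b α G Ψ) z =
      Complex.exp (Complex.I * ((α * ∑ i, G (z i) : ℝ) : ℂ)) *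
        ((1/2 : ℝ) * pder N (e i) v Ψ (asmS e y b z) +
          Complex.I * ((α * fderiv ℝ G (z i) v : ℝ) : ℂ) * Ψ (asmS e y b z)) := by
  have h1 : HasFDerivAt (fun z => Ψ (asmS e y b z))
      ((fderiv ℝ Ψ (asmS e y b z)).comp (asmD e)) z :=
    ((h.smooth.differentiable (by simp) _).hasFDerivAt).comp z (asmS_hasFDerivAt e y b z)
  have h2 : HasFDerivAt (fun z : Config n => ∑ i, G (z i)) (∑ i, (fderiv ℝ G (z i)).comp
      (ContinuousLinearMap.proj (R := ℝ) (φ := fun _ : Fin n => Plane) i)) z := by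
    refine HasFDerivAt.fun_sum fun i _ => ?_
    exact ((hG.differentiable (by simp) _).hasFDerivAt).comp z
      (hasFDerivAt_apply (𝕜 := ℝ) (F' := fun _ : Fin n => Plane) i z)
  have h3 := Complex.ofRealCLM.hasFDerivAt.comp z (h2.const_mul α)
  have h4 := ((h3.const_mul Complex.I).cexp).mul h1
  have h5 : HasFDerivAt (gaugeFn e y b α G Ψ) _ z := h4
  have h6 : ∑ k, fderiv ℝ G (z k) ((Pi.single i v : Config n) k) = fderiv ℝ G (z i) v := by
    rw [Finset.sum_eq_single i]
    · simp
    · intro k _ hk; simp [hk]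
    · simp
  unfold pder
  rw [h5.fderiv]
  simp [asmD_single, h6]
  ring

theorem gaugeFn_DSq (α : ℝ) {G : Plane → ℝ} (hG : ContDiff ℝ (⊤ : ℕ∞) G)
    {Ψ : Config N → ℂ} (h : Admissible N Ψ) (z : Config n) (i : Fin n)
    (hz : ∀ v : Plane, fderiv ℝ G (z i) v =
      (1/2) * ((∑ k, perpInv ((1/2 : ℝ) • (z i + b) - y k)).1 * v.1 +
        (∑ k, perpInv ((1/2 : ℝ) • (z i + b) - y k)).2 * v.2)) :
    DSq n α i (gaugeFn e y b α G Ψ) z = (1/4) * DSq N α (e i) Ψ (asmS e y b z) := by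
  set T := ∑ k, perpInv ((1/2 : ℝ) • (z i + b) - y k) with hT
  have hA := abPot_asmS e y b z i
  rw [← hT] at hA
  set E := Complex.exp (Complex.I * ((α * ∑ i, G (z i) : ℝ) : ℂ)) with hE
  have hEn : ‖E‖ = 1 := by
    rw [hE, mul_comm Complex.I, Complex.norm_exp_ofReal_mul_I]
  have e1 : (DOp n α i (gaugeFn e y b α G Ψ) z).1 =
      (E * ((1/2 : ℝ) : ℂ)) * (DOp N α (e i) Ψ (asmS e y b z)).1 := by
    simp only [DOp, gaugeFn_pder e y b α hG h, hz, hA, ← hE]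
    simp only [gaugeFn, ← hE, Prod.fst_add, Prod.smul_fst, smul_eq_mul]
    push_cast
    linear_combination (-E * α * T.1 / 2 * Ψ (asmS e y b z)) * Complex.I_sq
  have e2 : (DOp n α i (gaugeFn e y b α G Ψ) z).2 =
      (E * ((1/2 : ℝ) : ℂ)) * (DOp N α (e i) Ψ (asmS e y b z)).2 := by
    simp only [DOp, gaugeFn_pder e y b α hG h, hz, hA, ← hE]
    simp only [gaugeFn, ← hE, Prod.snd_add, Prod.smul_snd, smul_eq_mul]
    push_cast
    linear_combination (-E * α * T.2 / 2 * Ψ (asmS e y b z)) * Complex.I_sq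
  unfold DSq
  simp only [e1, e2, norm_mul, hEn, Complex.norm_real]
  norm_num
  ring

end asm

theorem change_var (n : ℕ) (q : Bool × Bool) (H : Config n → ℝ)
    (h : 0 ≤ ∫ w in cube n Q0, H fun i => (1/2 : ℝ) • (w i + corner q)) :
    0 ≤ ∫ z in cube n (sq4 q), H z := by
  have hm1 : MeasurableSet (cube n Q0) := (isOpen_cube n isOpen_Q0).measurableSet
  have hm2 : MeasurableSet (cube n (sq4 q)) := (isOpen_cube n (isOpen_sq4 q)).measurableSet
  rw [← integral_indicator hm1] at h
  rw [← integral_indicator hm2]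
  set f := (cube n (sq4 q)).indicator H with hf
  have e1 : (cube n Q0).indicator (fun w => H fun i => (1/2 : ℝ) • (w i + corner q)) =
      fun w : Config n => f ((1/2 : ℝ) • (w + fun _ => corner q)) := by
    funext w
    have : w ∈ cube n Q0 ↔ ((1/2 : ℝ) • (w + fun _ => corner q)) ∈ cube n (sq4 q) := by
      simp only [cube, Set.mem_univ_pi]
      exact forall_congr' fun i => (sq4_mem q (w i)).symm
    by_cases hw : w ∈ cube n Q0
    · rw [Set.indicator_of_mem hw, hf, Set.indicator_of_mem (this.1 hw)]
      rfl
    · rw [Set.indicator_of_notMem hw, hf, Set.indicator_of_notMem (fun h => hw (this.2 h))]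
  rw [e1, integral_add_right_eq_self (fun w : Config n => f ((1/2 : ℝ) • w)),
    Measure.integral_comp_smul, smul_eq_mul] at h
  refine nonneg_of_mul_nonneg_right h ?_
  positivity

theorem inner_bound {N n : ℕ} (hn : n ≠ 0) (α : ℝ) {Ψ : Config N → ℂ} (h : Admissible N Ψ)
    (s : Fin N → Bool × Bool) (q : Bool × Bool) (e : Fin n ≃ {j // s j = q})
    (y : {j // ¬ s j = q} → Plane) (hy : ∀ k : {j // ¬ s j = q}, y k ∈ sq4 (s k)) :
    0 ≤ ∫ z in cube n (sq4 q), (∑ i, DSq N α (e i) Ψ (asm e y z) -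
      4 * EN n α * ‖Ψ (asm e y z)‖ ^ 2) := by
  apply change_var
  choose θ hθ hθd using fun k : {j // ¬ s j = q} => exists_gauge (s k) q k.2 (y k) (hy k)
  let G : Plane → ℝ := fun w => ∑ k, θ k ((1/2 : ℝ) • (w + corner q))
  have hG : ContDiff ℝ (⊤ : ℕ∞) G := by
    refine ContDiff.sum fun k _ => (hθ k).comp ?_
    fun_prop
  have hGd : ∀ w ∈ Q0, ∀ v : Plane, fderiv ℝ G w v =
      (1/2) * ((∑ k, perpInv ((1/2 : ℝ) • (w + corner q) - y k)).1 * v.1 +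
        (∑ k, perpInv ((1/2 : ℝ) • (w + corner q) - y k)).2 * v.2) := by
    intro w hw v
    have h1 : HasFDerivAt (fun w : Plane => (1/2 : ℝ) • (w + corner q))
        ((1/2 : ℝ) • ContinuousLinearMap.id ℝ Plane) w :=
      ((hasFDerivAt_id w).add_const _).const_smul (1/2 : ℝ)
    have h2 : HasFDerivAt G (∑ k, (fderiv ℝ (θ k) ((1/2 : ℝ) • (w + corner q))).comp
        ((1/2 : ℝ) • ContinuousLinearMap.id ℝ Plane)) w := by
      refine HasFDerivAt.fun_sum fun k _ => ?_
      exact (((hθ k).differentiable (by simp) _).hasFDerivAt).comp w h1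
    rw [h2.fderiv, sum_apply]
    rw [Prod.fst_sum, Prod.snd_sum, Finset.sum_mul, Finset.sum_mul, ← Finset.sum_add_distrib,
      Finset.mul_sum]
    refine Finset.sum_congr rfl fun k _ => ?_
    rw [ContinuousLinearMap.comp_apply, hθd k _ ((sq4_mem q w).2 hw)]
    simp
    ring
  let Φ := gaugeFn e y (corner q) α G Ψ
  have hΦ : Admissible n Φ := gaugeFn_admissible e y (corner q) α hG h
  have e1 : ∫ w in cube n Q0, (∑ i, DSq N α (e i) Ψ (asm e y fun i => (1/2 : ℝ) • (w i + corner q)) -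
      4 * EN n α * ‖Ψ (asm e y fun i => (1/2 : ℝ) • (w i + corner q))‖ ^ 2) =
      ∫ w in cube n Q0, (∑ i, 4 * DSq n α i Φ w - 4 * EN n α * ‖Φ w‖ ^ 2) := by
    refine setIntegral_congr_fun (isOpen_cube n isOpen_Q0).measurableSet fun w hw => ?_
    simp only [Φ, gaugeFn_norm]
    congr 1
    refine Finset.sum_congr rfl fun i _ => ?_
    rw [gaugeFn_DSq e y (corner q) α hG h w i (hGd _ (hw i trivial))]
    unfold asmS
    ring
  rw [e1]
  have hc := hΦ.smooth.continuous
  have i1 : ∀ i ∈ Finset.univ, Integrable (fun w => 4 * DSq n α i Φ w) (volume.restrict (cube n Q0)) :=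
    fun i _ => integrableOn_cube (continuous_const.mul (DSq_continuous hΦ α i)) subset_rfl
  have i2 : Integrable (fun w => 4 * EN n α * ‖Φ w‖ ^ 2) (volume.restrict (cube n Q0)) :=
    integrableOn_cube (by fun_prop) subset_rfl
  rw [integral_sub (integrable_finsetSum _ i1) i2, integral_finsetSum _ i1, integral_const_mul]
  simp only [integral_const_mul]
  rw [← Finset.mul_sum]
  have := EN_mul_le hn hΦ α
  unfold normSq kinE at this
  linarith

theorem piece_bound {N n : ℕ} (hn : n ≠ 0) (α : ℝ) {Ψ : Config N → ℂ} (h : Admissible N Ψ)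
    (s : Fin N → Bool × Bool) (q : Bool × Bool) (e : Fin n ≃ {j // s j = q}) :
    0 ≤ ∫ x in Set.univ.pi fun j => sq4 (s j), (∑ i, DSq N α (e i) Ψ x -
      4 * EN n α * ‖Ψ x‖ ^ 2) := by
  set F : Config N → ℝ := fun x => ∑ i, DSq N α (e i) Ψ x - 4 * EN n α * ‖Ψ x‖ ^ 2 with hF
  let M1 : Config n × ({j // ¬ s j = q} → Plane) ≃ᵐ ({j // s j = q} → Plane) × ({j // ¬ s j = q} → Plane) :=
    MeasurableEquiv.prodCongr (MeasurableEquiv.piCongrLeft (fun _ => Plane) e) (MeasurableEquiv.refl _)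
  let M2 := MeasurableEquiv.piEquivPiSubtypeProd (fun _ : Fin N => Plane) (fun j => s j = q)
  let M := M1.trans M2.symm
  have hM : MeasurePreserving M := by
    have a1 : MeasurePreserving M1 :=
      (volume_measurePreserving_piCongrLeft (fun _ => Plane) e).prod (MeasurePreserving.id _)
    have a2 : MeasurePreserving M2.symm :=
      (volume_preserving_piEquivPiSubtypeProd (fun _ : Fin N => Plane) (fun j => s j = q)).symm M2
    exact a2.comp a1
  have hMa : ∀ z y, M (z, y) = asm e y z := by
    intro z y
    funext j
    by_cases hj : s j = q
    · obtain ⟨k, hk⟩ := e.surjective ⟨j, hj⟩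
      have hj' : j = e k := by rw [hk]
      subst hj'
      rw [asm_apply_e]
      have : M (z, y) (e k) = (MeasurableEquiv.piCongrLeft (fun _ => Plane) e) z (e k) := by
        simp [M, M1, M2, MeasurableEquiv.piEquivPiSubtypeProd, Equiv.piEquivPiSubtypeProd, hj]
        rfl
      rw [this]
      exact Equiv.piCongrLeft_apply_apply (fun _ => Plane) e z k
    · have hj2 : asm e y z j = y ⟨j, hj⟩ := asm_apply_not e y z ⟨j, hj⟩
      rw [hj2]
      simp [M, M1, M2, MeasurableEquiv.piEquivPiSubtypeProd, Equiv.piEquivPiSubtypeProd, hj]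
      rfl
  have hpre : M ⁻¹' (Set.univ.pi fun j => sq4 (s j)) =
      (cube n (sq4 q)) ×ˢ (Set.univ.pi fun k : {j // ¬ s j = q} => sq4 (s k)) := by
    ext ⟨z, y⟩
    rw [Set.mem_preimage, hMa, Set.mem_prod]
    simp only [cube, Set.mem_univ_pi]
    constructor
    · intro hh
      refine ⟨fun i => ?_, fun k => ?_⟩
      · have := hh (e i)
        rwa [asm_apply_e, (e i).2] at this
      · have := hh k
        rwa [asm_apply_not] at this
    · rintro ⟨h1, h2⟩ j
      by_cases hj : s j = q
      · simp only [asm, hj, dite_true]; exact h1 _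
      · simp only [asm, hj, dite_false]; exact h2 ⟨j, hj⟩
  rw [← hM.setIntegral_preimage_emb M.measurableEmbedding, hpre, Measure.volume_eq_prod,
    ← Measure.prod_restrict]
  by_cases hint : Integrable (fun p => F (M p)) ((volume.restrict (cube n (sq4 q))).prod
      (volume.restrict (Set.univ.pi fun k : {j // ¬ s j = q} => sq4 (s k))))
  · rw [integral_prod_symm _ hint]
    refine setIntegral_nonneg ?_ fun y hy => ?_
    · exact MeasurableSet.univ_pi fun k => (isOpen_sq4 _).measurableSet
    · simp only [hMa, hF]
      exact inner_bound hn α h s q e y fun k => hy k trivial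
  · rw [integral_undef hint]

theorem halfI_disjoint {a b : Bool} {t : ℝ} (h1 : t ∈ halfI a) (h2 : t ∈ halfI b) : a = b := by
  cases a <;> cases b <;> simp [halfI] at * <;> linarith

theorem halfI_subset (a : Bool) : halfI a ⊆ Set.Ioo 0 1 := by
  intro t ht
  cases a <;> simp [halfI] at * <;> constructor <;> linarith

theorem sq4_subset (q : Bool × Bool) : sq4 q ⊆ Q0 :=
  Set.prod_mono (halfI_subset _) (halfI_subset _)

theorem exists_halfI {t : ℝ} (h : t ∈ Set.Ioo (0:ℝ) 1) (h2 : t ≠ 1/2) : ∃ a, t ∈ halfI a := by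
  rcases lt_or_gt_of_ne h2 with h3 | h3
  · exact ⟨false, by simp only [halfI, Bool.false_eq_true, if_false]; exact ⟨h.1, h3⟩⟩
  · exact ⟨true, by simp only [halfI, if_true]; exact ⟨h3, h.2⟩⟩

theorem ae_ne_half : ∀ᵐ p : Plane, p.1 ≠ 1/2 ∧ p.2 ≠ 1/2 := by
  have h1 : ∀ᵐ p : Plane, p.1 ≠ 1/2 :=
    Measure.quasiMeasurePreserving_fst.ae (Measure.ae_ne volume (1/2 : ℝ))
  have h2 : ∀ᵐ p : Plane, p.2 ≠ 1/2 :=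
    Measure.quasiMeasurePreserving_snd.ae (Measure.ae_ne volume (1/2 : ℝ))
  exact h1.and h2

theorem cube_ae (N : ℕ) : (cube N Q0 : Set (Config N)) =ᵐ[volume]
    (⋃ s : Fin N → Bool × Bool, Set.univ.pi fun j => sq4 (s j) : Set (Config N)) := by
  have h : ∀ᵐ x : Config N, ∀ j, (x j).1 ≠ 1/2 ∧ (x j).2 ≠ 1/2 := by
    rw [ae_all_iff]
    intro j
    exact (Measure.quasiMeasurePreserving_eval (fun _ : Fin N => (volume : Measure Plane)) j).ae ae_ne_half
  refine Filter.eventuallyEq_set.2 ?_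
  filter_upwards [h] with x hx
  constructor
  · intro hc
    choose a ha using fun j => exists_halfI (hc j trivial).1 (hx j).1
    choose b hb using fun j => exists_halfI (hc j trivial).2 (hx j).2
    exact Set.mem_iUnion.2 ⟨fun j => (a j, b j), fun j _ => ⟨ha j, hb j⟩⟩
  · intro hc
    obtain ⟨s, hs⟩ := Set.mem_iUnion.1 hc
    exact fun j _ => sq4_subset _ (hs j trivial)

theorem integral_cube_split {N : ℕ} {f : Config N → ℝ} (hf : Continuous f) :
    ∫ x in cube N Q0, f x = ∑ s : Fin N → Bool × Bool, ∫ x in Set.univ.pi fun j => sq4 (s j), f x := by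
  rw [setIntegral_congr_set (cube_ae N), integral_iUnion_fintype]
  · exact fun s => MeasurableSet.univ_pi fun j => (isOpen_sq4 _).measurableSet
  · intro s t hst
    rw [Function.onFun, Set.disjoint_left]
    intro x hs ht
    apply hst
    funext j
    exact Prod.ext (halfI_disjoint (hs j trivial).1 (ht j trivial).1)
      (halfI_disjoint (hs j trivial).2 (ht j trivial).2)
  · exact fun s => integrableOn_cube hf (Set.pi_mono fun j _ => sq4_subset _)

/-- Recursive lower bound: for every `α ∈ [0,1]` and every `N ≥ 2`,
`E^N_N(α) ≥ 4 min{E^N_k(α) : ⌈N/4⌉ ≤ k ≤ N}`. -/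
theorem recursive_lower_bound (α : ℝ) (hα : α ∈ Set.Icc (0 : ℝ) 1) (N : ℕ) (hN : 2 ≤ N) :
    4 * sInf {e : ℝ | ∃ k : ℕ, ⌈(N : ℝ) / 4⌉₊ ≤ k ∧ k ≤ N ∧ e = EN k α} ≤ EN N α := by
  set m := sInf {e : ℝ | ∃ k : ℕ, ⌈(N : ℝ) / 4⌉₊ ≤ k ∧ k ≤ N ∧ e = EN k α} with hm
  have hmle : ∀ k : ℕ, ⌈(N : ℝ) / 4⌉₊ ≤ k → k ≤ N → m ≤ EN k α := by
    intro k h1 h2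
    refine csInf_le ⟨0, ?_⟩ ⟨k, h1, h2, rfl⟩
    rintro _ ⟨k, -, -, rfl⟩
    exact EN_nonneg k α
  have hN0 : N ≠ 0 := by omega
  have hEN : EN N α = sInf {E | ∃ Ψ : Config N → ℂ, Admissible N Ψ ∧ normSq N Q0 Ψ = 1 ∧
      E = kinE N α Q0 Ψ} := by
    unfold EN neumannE
    rw [if_neg hN0]
  rw [hEN]
  apply le_csInf
  · obtain ⟨Ψ, h1, h2⟩ := exists_admissible N
    exact ⟨_, Ψ, h1, h2, rfl⟩
  rintro _ ⟨Ψ, hΨ, hnorm, rfl⟩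
  have hc := hΨ.smooth.continuous
  have hc2 : Continuous fun x => ‖Ψ x‖ ^ 2 := by fun_prop
  have hD := DSq_continuous hΨ α
  have key : ∀ s : Fin N → Bool × Bool,
      4 * m * ∫ x in Set.univ.pi fun j => sq4 (s j), ‖Ψ x‖ ^ 2 ≤
        ∑ j, ∫ x in Set.univ.pi fun j => sq4 (s j), DSq N α j Ψ x := by
    intro s
    have hsub : (Set.univ.pi fun j => sq4 (s j)) ⊆ cube N Q0 := Set.pi_mono fun j _ => sq4_subset _
    obtain ⟨q, hq⟩ := Fintype.exists_le_card_fiber_of_nsmul_le_card (f := s) (b := (N : ℝ) / 4)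
      (by simp; linarith)
    set n := Fintype.card {j // s j = q} with hn
    have hq' : (N : ℝ) / 4 ≤ n := by
      rw [hn, Fintype.card_subtype]; exact hq
    have hnN : n ≤ N := by
      have := Fintype.card_subtype_le (fun j => s j = q)
      simpa using this
    have hn0 : n ≠ 0 := by
      intro h0
      rw [h0] at hq'
      have : (2:ℝ) ≤ N := by exact_mod_cast hN
      norm_num at hq'
      linarith
    have hme := hmle n (Nat.ceil_le.2 hq') hnN
    let e : Fin n ≃ {j // s j = q} := (Fintype.equivFin _).symm
    have hp := piece_bound hn0 α hΨ s q e
    have i1 : ∀ i ∈ Finset.univ, Integrable (fun x => DSq N α (e i) Ψ x)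
        (volume.restrict (Set.univ.pi fun j => sq4 (s j))) :=
      fun i _ => integrableOn_cube (hD _) hsub
    have i2 : Integrable (fun x => 4 * EN n α * ‖Ψ x‖ ^ 2)
        (volume.restrict (Set.univ.pi fun j => sq4 (s j))) :=
      integrableOn_cube (by fun_prop) hsub
    rw [integral_sub (integrable_finsetSum _ i1) i2, integral_finsetSum _ i1,
      integral_const_mul] at hp
    have h0 : 0 ≤ ∫ x in Set.univ.pi fun j => sq4 (s j), ‖Ψ x‖ ^ 2 :=
      integral_nonneg fun x => by positivity
    rw [sum_split e]
    have h1 : 0 ≤ ∑ k : {j // ¬ s j = q}, ∫ x in Set.univ.pi fun j => sq4 (s j), DSq N α k Ψ x :=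
      Finset.sum_nonneg fun k _ => integral_nonneg fun x => DSq_nonneg _ _ _ _ _
    have h2 := mul_le_mul_of_nonneg_right hme h0
    linarith
  calc 4 * m = 4 * m * normSq N Q0 Ψ := by rw [hnorm, mul_one]
    _ = ∑ s : Fin N → Bool × Bool, 4 * m * ∫ x in Set.univ.pi fun j => sq4 (s j), ‖Ψ x‖ ^ 2 := by
        unfold normSq
        rw [integral_cube_split hc2, Finset.mul_sum]
    _ ≤ ∑ s : Fin N → Bool × Bool, ∑ j, ∫ x in Set.univ.pi fun j => sq4 (s j), DSq N α j Ψ x :=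
        Finset.sum_le_sum fun s _ => key s
    _ = kinE N α Q0 Ψ := by
        unfold kinE
        rw [Finset.sum_comm]
        exact Finset.sum_congr rfl fun j _ => (integral_cube_split (hD j)).symm
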